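/- arXiv:2107.01249 — 4 statements merged into one kernel-verified Lean document; each statement's English description precedes it below -/
import Mathlib

section
/- Let R be a commutative ring, L a Lie algebra over R, and let D and (M_α)_{α∈Φ} be R-submodules of L such that: ⁅D,D⁆ ⊆ D; ⁅D, M_α⁆ ⊆ M_α for every α ∈ Φ; and for all α, β ∈ Φ one has ⁅M_α, M_β⁆ ⊆ M_{α+β} if α+β ∈ Φ, ⁅M_α, M_β⁆ ⊆ D if α+β = 0, and ⁅M_α, M_β⁆ = 0 if α+β ∉ Φ ∪ {0}. Then for every net of ideals σ of R (relative to Δ ⊆ Φ), the R-submodule L(σ) = D + Σ_{α∈Φ} σ_α·M_α is a Lie subalgebra of L. -/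
/-- A net of ideals relative to `Δ ⊆ Φ`: `σ_α·σ_β ⊆ σ_{α+β}` whenever
`α, β, α+β ∈ Φ`, and `σ_α = R` for `α ∈ Δ`. -/
def IsNet {Q : Type*} [AddCommGroup Q] {R : Type*} [CommRing R]
    (Φ Δ : Set Q) (σ : Q → Ideal R) : Prop :=
  (∀ α β : Q, α ∈ Φ → β ∈ Φ → α + β ∈ Φ → σ α * σ β ≤ σ (α + β)) ∧
  (∀ α ∈ Δ, σ α = ⊤)

/-- If the bracket sends `A × B` into `C`, it sends `I • A × J • B` into `(I * J) • C`. -/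
theorem lie_mem_mul_smul {R L : Type*} [CommRing R] [LieRing L] [LieAlgebra R L]
    {A B C : Submodule R L} (h : ∀ x ∈ A, ∀ y ∈ B, ⁅x, y⁆ ∈ C) (I J : Ideal R) :
    ∀ x ∈ I • A, ∀ y ∈ J • B, ⁅x, y⁆ ∈ (I * J) • C := by
  intro x hx y hy
  induction hx using Submodule.smul_induction_on' with
  | smul r hr a ha =>
    induction hy using Submodule.smul_induction_on' with
    | smul s hs b hb =>
      rw [smul_lie, lie_smul, smul_smul]
      exact Submodule.smul_mem_smul (Ideal.mul_mem_mul hr hs) (h a ha b hb)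
    | add y₁ _ y₂ _ h₁ h₂ =>
      rw [lie_add]
      exact add_mem h₁ h₂
  | add x₁ _ x₂ _ h₁ h₂ =>
    rw [add_lie]
    exact add_mem h₁ h₂

/-- Given submodules `D` and `(M_α)_{α∈Φ}` of a Lie algebra `L` satisfying the
multiplication rules of the toric subalgebra and the root subspaces of a
Chevalley algebra, for every net of ideals `σ` the submodule
`L(σ) = D + Σ_{α∈Φ} σ_α·M_α` is a Lie subalgebra of `L`. -/
theorem net_submodule_is_lie_subalgebra
    {Q : Type*} [AddCommGroup Q] {R : Type*} [CommRing R]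
    {L : Type*} [LieRing L] [LieAlgebra R L]
    (Φ Δ : Set Q) (hΦfin : Φ.Finite) (hΦ0 : (0 : Q) ∉ Φ)
    (hΦneg : ∀ α ∈ Φ, -α ∈ Φ) (hΔΦ : Δ ⊆ Φ) (hΔneg : ∀ α ∈ Δ, -α ∈ Δ)
    (D : Submodule R L) (M : Q → Submodule R L)
    (hDD : ∀ x ∈ D, ∀ y ∈ D, ⁅x, y⁆ ∈ D)
    (hDM : ∀ α ∈ Φ, ∀ x ∈ D, ∀ m ∈ M α, ⁅x, m⁆ ∈ M α)
    (hMM : ∀ α ∈ Φ, ∀ β ∈ Φ, α + β ∈ Φ →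
      ∀ x ∈ M α, ∀ y ∈ M β, ⁅x, y⁆ ∈ M (α + β))
    (hMD : ∀ α ∈ Φ, ∀ β ∈ Φ, α + β = 0 →
      ∀ x ∈ M α, ∀ y ∈ M β, ⁅x, y⁆ ∈ D)
    (hM0 : ∀ α ∈ Φ, ∀ β ∈ Φ, α + β ∉ Φ → α + β ≠ 0 →
      ∀ x ∈ M α, ∀ y ∈ M β, ⁅x, y⁆ = 0)
    (σ : Q → Ideal R) (hσ : IsNet Φ Δ σ) :
    ∃ K : LieSubalgebra R L,
      (K : Submodule R L) = D ⊔ ⨆ α ∈ Φ, σ α • M α := by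
  set S := D ⊔ ⨆ α ∈ Φ, σ α • M α with hS
  have hDS : D ≤ S := le_sup_left
  have hMS : ∀ α ∈ Φ, σ α • M α ≤ S := fun α hα ↦
    (le_biSup (fun α ↦ σ α • M α) hα).trans le_sup_right
  have hDσM : ∀ α ∈ Φ, ∀ x ∈ D, ∀ y ∈ σ α • M α, ⁅x, y⁆ ∈ S := fun α hα x hx y hy ↦ by
    have h := lie_mem_mul_smul (hDM α hα) ⊤ (σ α) x (by simpa using hx) y hy
    rw [Ideal.top_mul] at h
    exact hMS α hα h
  have hσMσM : ∀ α ∈ Φ, ∀ β ∈ Φ, ∀ x ∈ σ α • M α, ∀ y ∈ σ β • M β, ⁅x, y⁆ ∈ S := by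
    intro α hα β hβ x hx y hy
    by_cases hΦ : α + β ∈ Φ
    · exact hMS _ hΦ (Submodule.smul_mono_left (hσ.1 α β hα hβ hΦ)
        (lie_mem_mul_smul (hMM α hα β hβ hΦ) _ _ x hx y hy))
    · by_cases h0 : α + β = 0
      · exact hDS (hMD α hα β hβ h0 x (Submodule.smul_le_right hx) y
          (Submodule.smul_le_right hy))
      · rw [hM0 α hα β hβ hΦ h0 x (Submodule.smul_le_right hx) y
          (Submodule.smul_le_right hy)]
        exact zero_mem S
  let f : L →ₗ[R] L →ₗ[R] L := (LieModule.toEnd R L L : L →ₗ[R] Module.End R L)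
  have hf : Submodule.map₂ f S S ≤ S := by
    conv_lhs => rw [hS]
    simp only [Submodule.map₂_sup_left, Submodule.map₂_sup_right, Submodule.map₂_iSup_left,
      Submodule.map₂_iSup_right, sup_le_iff, iSup_le_iff, Submodule.map₂_le]
    refine ⟨⟨fun x hx y hy ↦ hDS (hDD x hx y hy), fun α hα x hx y hy ↦ ?_⟩,
      fun β hβ ↦ ⟨hDσM β hβ, fun α hα ↦ hσMσM α hα β hβ⟩⟩
    change ⁅x, y⁆ ∈ S
    rw [← lie_skew]
    exact neg_mem (hDσM α hα y hy x hx)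
  have hlie {x y : L} (hx : x ∈ S) (hy : y ∈ S) : ⁅x, y⁆ ∈ S :=
    hf (Submodule.apply_mem_map₂ f hx hy)
  exact ⟨{ S with lie_mem' := hlie }, rfl⟩
end

section
/- Let σ be a net of ideals of R (relative to Δ ⊆ Φ). Then for every prime ideal P of R there exists a defining prime ideal P₁ of R with P₁ ⊆ P and Δ'_{P₁} = Δ'_P. -/
/-- `Δ'_P = {α ∈ Φ : σ_α ⊄ P}`. -/
def deltaPrime {Q : Type*} [AddCommGroup Q] {R : Type*} [CommRing R]
    (Φ : Set Q) (σ : Q → Ideal R) (P : Ideal R) : Set Q :=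
  {α ∈ Φ | ¬ σ α ≤ P}

/-- A prime `P` is defining if it is minimal by inclusion in the set of
primes `P'` with `Δ'_{P'} = Δ'_P`. -/
def IsDefining {Q : Type*} [AddCommGroup Q] {R : Type*} [CommRing R]
    (Φ : Set Q) (σ : Q → Ideal R) (P : Ideal R) : Prop :=
  P.IsPrime ∧ ∀ P' : Ideal R, P'.IsPrime →
    deltaPrime Φ σ P' = deltaPrime Φ σ P → P' ≤ P → P' = P

/-- For every prime ideal `P` there exists a defining prime ideal `P₁ ⊆ P`
with `Δ'_{P₁} = Δ'_P`. -/
theorem exists_defining_prime {Q : Type*} [AddCommGroup Q] {R : Type*} [CommRing R]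
    (Φ Δ : Set Q) (hΦfin : Φ.Finite) (hΦ0 : (0 : Q) ∉ Φ)
    (hΦneg : ∀ α ∈ Φ, -α ∈ Φ) (hΔΦ : Δ ⊆ Φ) (hΔneg : ∀ α ∈ Δ, -α ∈ Δ)
    (σ : Q → Ideal R) (hσ : IsNet Φ Δ σ)
    (P : Ideal R) (hP : P.IsPrime) :
    ∃ P₁ : Ideal R, IsDefining Φ σ P₁ ∧ P₁ ≤ P ∧
      deltaPrime Φ σ P₁ = deltaPrime Φ σ P := by
  let I : Ideal R := ⨆ α ∈ Φ, ⨆ _ : σ α ≤ P, σ α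
  have I_le {P' : Ideal R} (h : deltaPrime Φ σ P' = deltaPrime Φ σ P) : I ≤ P' := by
    refine iSup₂_le fun α hα => iSup_le fun hαP => ?_
    by_contra hαP'
    have hmem : α ∈ deltaPrime Φ σ P' := ⟨hα, hαP'⟩
    rw [h] at hmem
    exact hmem.2 hαP
  obtain ⟨P₁, hP₁, hle⟩ := Ideal.exists_minimalPrimes_le (I_le (P' := P) rfl)
  have heq : deltaPrime Φ σ P₁ = deltaPrime Φ σ P := by
    ext α
    refine and_congr_right fun hα => not_congr ⟨fun h => h.trans hle, fun h => ?_⟩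
    exact (le_iSup₂_of_le α hα (le_iSup (fun _ : σ α ≤ P => σ α) h)).trans hP₁.1.2
  refine ⟨P₁, ⟨hP₁.1.1, fun P' hP' h hP'le => ?_⟩, hle, heq⟩
  exact le_antisymm hP'le (hP₁.2 ⟨hP', I_le (h.trans heq)⟩ hP'le)
end

section
/- Let σ be a net of ideals of R (relative to Δ ⊆ Φ). If the ring R is Noetherian, then the set Θ of all defining prime ideals of R is finite. -/
/-- If `R` is Noetherian, then the set `Θ` of all defining prime ideals
is finite. -/
theorem finite_defining_primes {Q : Type*} [AddCommGroup Q] {R : Type*} [CommRing R]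
    [IsNoetherianRing R]
    (Φ Δ : Set Q) (hΦfin : Φ.Finite) (hΦ0 : (0 : Q) ∉ Φ)
    (hΦneg : ∀ α ∈ Φ, -α ∈ Φ) (hΔΦ : Δ ⊆ Φ) (hΔneg : ∀ α ∈ Δ, -α ∈ Δ)
    (σ : Q → Ideal R) (hσ : IsNet Φ Δ σ) :
    {P : Ideal R | IsDefining Φ σ P}.Finite := by
  refine (hΦfin.finite_subsets.biUnion fun T _ ↦
    (⨆ α ∈ T, σ α).finite_minimalPrimes_of_isNoetherianRing R).subset ?_
  rintro P ⟨hP, hmin⟩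
  obtain ⟨P', hP', hle⟩ := Ideal.exists_minimalPrimes_le
    (I := ⨆ α ∈ {α ∈ Φ | σ α ≤ P}, σ α) (J := P) (iSup₂_le fun α hα ↦ hα.2)
  have h_iff (α : Q) (hα : α ∈ Φ) : σ α ≤ P' ↔ σ α ≤ P :=
    ⟨fun h ↦ h.trans hle, fun h ↦ (le_iSup₂_of_le α ⟨hα, h⟩ le_rfl).trans hP'.1.2⟩
  have h_eq : P' = P := hmin P' hP'.1.1
    (Set.ext fun α ↦ and_congr_right fun hα ↦ not_congr (h_iff α hα)) hle
  exact Set.mem_biUnion (Set.sep_subset Φ fun α ↦ σ α ≤ P) (h_eq ▸ hP')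
end

section
/- Let R be a commutative ring with Jacobson radical J(R), let R₁ ⊆ R be a subring, and let S = R₁ ∩ R^× be the multiplicative set of elements of R₁ that are invertible in R. Then for every x ∈ R₁ ∩ J(R), the image of x in the localization S⁻¹R₁ lies in the Jacobson radical of S⁻¹R₁. -/
/-- The multiplicative set `S = R₁ ∩ R^×` of elements of the subring `R₁`
that are invertible in the ambient ring `R`. -/
def unitsSubmonoid {R : Type*} [CommRing R] (R₁ : Subring R) : Submonoid R₁ where
  carrier := {x : R₁ | IsUnit (x : R)}
  one_mem' := by simp
  mul_mem' := by
    intro a b ha hb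
    simp only [Set.mem_setOf_eq, Subring.coe_mul] at *
    exact ha.mul hb

/-- If `x ∈ R₁ ∩ J(R)`, then the image of `x` in the localization `S⁻¹R₁`
lies in the Jacobson radical of `S⁻¹R₁`. -/
theorem mem_jacobson_localization {R : Type*} [CommRing R] (R₁ : Subring R)
    (x : R₁) (hx : (x : R) ∈ Ideal.jacobson (⊥ : Ideal R)) :
    algebraMap R₁ (Localization (unitsSubmonoid R₁)) x ∈
      Ideal.jacobson (⊥ : Ideal (Localization (unitsSubmonoid R₁))) := by
  rw [Ideal.mem_jacobson_bot] at hx ⊢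
  intro y
  obtain ⟨a, s, rfl⟩ := IsLocalization.exists_mk'_eq (unitsSubmonoid R₁) y
  obtain ⟨u, hu⟩ : IsUnit ((s : R₁) : R) := s.2
  have hmem : x * a + s ∈ unitsSubmonoid R₁ := by
    have hfactor : ((x * a + s : R₁) : R) = u * ((x : R) * (a * ↑u⁻¹) + 1) := by
      push_cast
      rw [← hu]
      linear_combination -((x : R) * a) * u.mul_inv
    change IsUnit ((x * a + s : R₁) : R)
    rw [hfactor]
    exact u.isUnit.mul (hx _)
  refine isUnit_of_mul_isUnit_left (y := algebraMap R₁ _ s) ?_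
  rw [add_mul, mul_assoc, IsLocalization.mk'_spec, one_mul, ← map_mul, ← map_add]
  exact IsLocalization.map_units _ (⟨_, hmem⟩ : unitsSubmonoid R₁)
end
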